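/- Let U⁺ be the subalgebra of U_{r,s}(𝔤) generated by {e_i : i ∈ I}. For every i ∈ I and every P ∈ U⁺, there exist unique elements L, R ∈ U⁺ such that (r_i − s_i)(P f_i − f_i P) = ω_i L − ω_i' R in U_{r,s}(𝔤). (One writes ∂_i(P) = L and ∂_i'(P) = R.) -/

import Mathlib

noncomputable section

/-- The q-integer `(m)_v = 1 + v + ⋯ + v^{m-1}`. -/
def qnat {K : Type} [CommRing K] (v : K) (m : ℕ) : K := ∑ i ∈ Finset.range m, v ^ i

/-- The Gaussian binomial coefficient `binom(m,k)_v`, as a polynomial expression in `v`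
(defined through the Pascal-type recurrence). -/
def qbinom {K : Type} [CommRing K] (v : K) : ℕ → ℕ → K
  | _, 0 => 1
  | 0, _ + 1 => 0
  | m + 1, k + 1 => qbinom v m k + v ^ (k + 1) * qbinom v m (k + 1)

/-- The Euler (Ringel) form on basis elements: `⟨α_i, α_j⟩ = d_i a_{ij}` if `i < j`,
`d_i` if `i = j`, and `0` if `i > j`. -/
def eulB {n : ℕ} (a : Fin n → Fin n → ℤ) (d : Fin n → ℤ) (i j : Fin n) : ℤ :=
  if i < j then d i * a i j else if i = j then d i else 0

/-- The Euler form on the root lattice `Q = Fin n → ℤ` (coordinates in the basis `α_i`). -/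
def euler {n : ℕ} (a : Fin n → Fin n → ℤ) (d : Fin n → ℤ) (μ ν : Fin n → ℤ) : ℤ :=
  ∑ i, ∑ j, μ i * ν j * eulB a d i j

/-- The coefficient `c^{(k)}_{ij} = (r_i s_i⁻¹)^{k(k-1)/2} r^{k⟨α_j,α_i⟩} s^{-k⟨α_i,α_j⟩}`. -/
def ccoef {K : Type} [Field K] {n : ℕ} (a : Fin n → Fin n → ℤ) (d : Fin n → ℤ)
    (r s : K) (i j : Fin n) (k : ℕ) : K :=
  (r ^ d i * (s ^ d i)⁻¹) ^ (k * (k - 1) / 2) *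
    r ^ ((k : ℤ) * eulB a d j i) * (s ^ ((k : ℤ) * eulB a d i j))⁻¹

/-- The `(r,s)`-Serre element
`∑_{k=0}^{1-a_{ij}} (-1)^k binom(1-a_{ij},k)_{r_i s_i⁻¹} c^{(k)}_{ij} E_i^{1-a_{ij}-k} E_j E_i^k`. -/
def serreElt {K : Type} [Field K] {n : ℕ} (a : Fin n → Fin n → ℤ) (d : Fin n → ℤ)
    (r s : K) {A : Type} [Ring A] [Algebra K A] (E : Fin n → A) (i j : Fin n) : A :=
  ∑ k ∈ Finset.range ((1 - a i j).toNat + 1),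
    ((-1 : K) ^ k * qbinom (r ^ d i * (s ^ d i)⁻¹) ((1 - a i j).toNat) k *
        ccoef a d r s i j k) •
      (E i ^ ((1 - a i j).toNat - k) * E j * E i ^ k)

/-- The defining relations of `U⁺_{r,s}`: the `(r,s)`-Serre relations. -/
inductive SerreRel (K : Type) [Field K] {n : ℕ} (a : Fin n → Fin n → ℤ) (d : Fin n → ℤ)
    (r s : K) : FreeAlgebra K (Fin n) → FreeAlgebra K (Fin n) → Prop
  | rel (i j : Fin n) (h : i ≠ j) :
      SerreRel K a d r s (serreElt a d r s (FreeAlgebra.ι K) i j) 0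

/-- `U⁺_{r,s}`: the algebra generated by the `e_i` subject only to the `(r,s)`-Serre
relations. -/
abbrev Uplus (K : Type) [Field K] {n : ℕ} (a : Fin n → Fin n → ℤ) (d : Fin n → ℤ)
    (r s : K) : Type := RingQuot (SerreRel K a d r s)

/-- The generator `e_i` of `U⁺_{r,s}`. -/
def eP (K : Type) [Field K] {n : ℕ} (a : Fin n → Fin n → ℤ) (d : Fin n → ℤ)
    (r s : K) (i : Fin n) : Uplus K a d r s :=
  RingQuot.mkAlgHom K (SerreRel K a d r s) (FreeAlgebra.ι K i)

/-- The degree-`μ` homogeneous component of `U⁺_{r,s}` for `μ ∈ Q⁺`: the span of the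
monomials in the `e_i` in which `e_i` occurs exactly `μ i` times. -/
def UplusDeg (K : Type) [Field K] {n : ℕ} (a : Fin n → Fin n → ℤ) (d : Fin n → ℤ)
    (r s : K) (μ : Fin n → ℕ) : Submodule K (Uplus K a d r s) :=
  Submodule.span K
    {x | ∃ w : List (Fin n), (∀ i, w.count i = μ i) ∧ x = (w.map (eP K a d r s)).prod}


/-- The `(r,s)`-Serre element for the negative generators:
`∑_{k=0}^{1-a_{ij}} (-1)^k binom(1-a_{ij},k)_{r_i s_i⁻¹} c^{(k)}_{ij} F_i^k F_j F_i^{1-a_{ij}-k}`. -/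
def serreEltF {K : Type} [Field K] {n : ℕ} (a : Fin n → Fin n → ℤ) (d : Fin n → ℤ)
    (r s : K) {A : Type} [Ring A] [Algebra K A] (F : Fin n → A) (i j : Fin n) : A :=
  ∑ k ∈ Finset.range ((1 - a i j).toNat + 1),
    ((-1 : K) ^ k * qbinom (r ^ d i * (s ^ d i)⁻¹) ((1 - a i j).toNat) k *
        ccoef a d r s i j k) •
      (F i ^ k * F j * F i ^ ((1 - a i j).toNat - k))

/-- The field `ℚ(r,s)` of rational functions in two variables over `ℚ`. -/
abbrev K2 : Type := FractionRing (MvPolynomial (Fin 2) ℚ)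

/-- The parameter `r ∈ ℚ(r,s)`. -/
def rr : K2 := algebraMap (MvPolynomial (Fin 2) ℚ) K2 (MvPolynomial.X 0)

/-- The parameter `s ∈ ℚ(r,s)`. -/
def ss : K2 := algebraMap (MvPolynomial (Fin 2) ℚ) K2 (MvPolynomial.X 1)

/-- Generators of the two-parameter quantum group `U_{r,s}(𝔤)`:
`e_i, f_i, ω_i^{±1}, ω_i'^{±1}`. -/
inductive Gen (n : ℕ) : Type
  | e (i : Fin n) : Gen n
  | f (i : Fin n) : Gen n
  | w (i : Fin n) : Gen n
  | winv (i : Fin n) : Gen n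
  | w' (i : Fin n) : Gen n
  | w'inv (i : Fin n) : Gen n

/-- The four toral generators `ω_i, ω_i^{-1}, ω_i', ω_i'^{-1}` attached to `i`. -/
def tor {n : ℕ} (i : Fin n) : Bool → Bool → Gen n
  | false, false => Gen.w i
  | false, true => Gen.winv i
  | true, false => Gen.w' i
  | true, true => Gen.w'inv i

/-- The defining relations (R1)–(R6) of the two-parameter quantum group `U_{r,s}(𝔤)`. -/
inductive URel {n : ℕ} (a : Fin n → Fin n → ℤ) (d : Fin n → ℤ) :
    FreeAlgebra K2 (Gen n) → FreeAlgebra K2 (Gen n) → Prop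
  | torComm (i j : Fin n) (p q p' q' : Bool) :
      URel a d (FreeAlgebra.ι K2 (tor i p q) * FreeAlgebra.ι K2 (tor j p' q'))
        (FreeAlgebra.ι K2 (tor j p' q') * FreeAlgebra.ι K2 (tor i p q))
  | wInvR (i : Fin n) :
      URel a d (FreeAlgebra.ι K2 (Gen.w i) * FreeAlgebra.ι K2 (Gen.winv i)) 1
  | wInvL (i : Fin n) :
      URel a d (FreeAlgebra.ι K2 (Gen.winv i) * FreeAlgebra.ι K2 (Gen.w i)) 1
  | w'InvR (i : Fin n) :
      URel a d (FreeAlgebra.ι K2 (Gen.w' i) * FreeAlgebra.ι K2 (Gen.w'inv i)) 1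
  | w'InvL (i : Fin n) :
      URel a d (FreeAlgebra.ι K2 (Gen.w'inv i) * FreeAlgebra.ι K2 (Gen.w' i)) 1
  | we (i j : Fin n) :
      URel a d (FreeAlgebra.ι K2 (Gen.w i) * FreeAlgebra.ι K2 (Gen.e j))
        ((rr ^ eulB a d j i * (ss ^ eulB a d i j)⁻¹) •
          (FreeAlgebra.ι K2 (Gen.e j) * FreeAlgebra.ι K2 (Gen.w i)))
  | w'e (i j : Fin n) :
      URel a d (FreeAlgebra.ι K2 (Gen.w' i) * FreeAlgebra.ι K2 (Gen.e j))
        (((rr ^ eulB a d i j)⁻¹ * ss ^ eulB a d j i) •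
          (FreeAlgebra.ι K2 (Gen.e j) * FreeAlgebra.ι K2 (Gen.w' i)))
  | wf (i j : Fin n) :
      URel a d (FreeAlgebra.ι K2 (Gen.w i) * FreeAlgebra.ι K2 (Gen.f j))
        (((rr ^ eulB a d j i)⁻¹ * ss ^ eulB a d i j) •
          (FreeAlgebra.ι K2 (Gen.f j) * FreeAlgebra.ι K2 (Gen.w i)))
  | w'f (i j : Fin n) :
      URel a d (FreeAlgebra.ι K2 (Gen.w' i) * FreeAlgebra.ι K2 (Gen.f j))
        ((rr ^ eulB a d i j * (ss ^ eulB a d j i)⁻¹) •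
          (FreeAlgebra.ι K2 (Gen.f j) * FreeAlgebra.ι K2 (Gen.w' i)))
  | ef (i j : Fin n) :
      URel a d
        (FreeAlgebra.ι K2 (Gen.e i) * FreeAlgebra.ι K2 (Gen.f j) -
          FreeAlgebra.ι K2 (Gen.f j) * FreeAlgebra.ι K2 (Gen.e i))
        (if i = j then
          ((rr ^ d i - ss ^ d i)⁻¹) •
            (FreeAlgebra.ι K2 (Gen.w i) - FreeAlgebra.ι K2 (Gen.w' i))
         else 0)
  | serreE (i j : Fin n) (h : i ≠ j) :
      URel a d (serreElt a d rr ss (fun k => FreeAlgebra.ι K2 (Gen.e k)) i j) 0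
  | serreF (i j : Fin n) (h : i ≠ j) :
      URel a d (serreEltF a d rr ss (fun k => FreeAlgebra.ι K2 (Gen.f k)) i j) 0

/-- The two-parameter quantum group `U_{r,s}(𝔤)` over `ℚ(r,s)`. -/
abbrev Uq {n : ℕ} (a : Fin n → Fin n → ℤ) (d : Fin n → ℤ) : Type :=
  RingQuot (URel a d)

/-- The image of a generator in `U_{r,s}(𝔤)`. -/
def gU {n : ℕ} (a : Fin n → Fin n → ℤ) (d : Fin n → ℤ) (x : Gen n) : Uq a d :=
  RingQuot.mkAlgHom K2 (URel a d) (FreeAlgebra.ι K2 x)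

/-- The subalgebra `U⁺` of `U_{r,s}(𝔤)` generated by the `e_i`. -/
def Upos {n : ℕ} (a : Fin n → Fin n → ℤ) (d : Fin n → ℤ) : Subalgebra K2 (Uq a d) :=
  Algebra.adjoin K2 (Set.range fun i => gU a d (Gen.e i))

/-- The subalgebra `U⁻` of `U_{r,s}(𝔤)` generated by the `f_i`. -/
def Uneg {n : ℕ} (a : Fin n → Fin n → ℤ) (d : Fin n → ℤ) : Subalgebra K2 (Uq a d) :=
  Algebra.adjoin K2 (Set.range fun i => gU a d (Gen.f i))

/-- The subalgebra `U⁰` of `U_{r,s}(𝔤)` generated by the `ω_i^{±1}, ω_i'^{±1}`. -/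
def Uzero {n : ℕ} (a : Fin n → Fin n → ℤ) (d : Fin n → ℤ) : Subalgebra K2 (Uq a d) :=
  Algebra.adjoin K2 (Set.range fun p : Fin n × Bool × Bool => gU a d (tor p.1 p.2.1 p.2.2))

/-- The generator `e_i` of `U⁺ ⊆ U_{r,s}(𝔤)`, as an element of the subalgebra `U⁺`. -/
def eUp {n : ℕ} (a : Fin n → Fin n → ℤ) (d : Fin n → ℤ) (i : Fin n) : ↥(Upos a d) :=
  ⟨gU a d (Gen.e i), Algebra.subset_adjoin (Set.mem_range_self i)⟩

/-- Iterated skew commutators: `y ↦ x y - v^k β y x` for `k = 0, 1, …`, starting from `y`. -/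
def iterSkew {K A : Type} [Field K] [Ring A] [Algebra K A] (x y : A) (β v : K) : ℕ → A
  | 0 => y
  | k + 1 => x * iterSkew x y β v k - (v ^ k * β) • (iterSkew x y β v k * x)

theorem iterSkew_succ' {K A : Type} [Field K] [Ring A] [Algebra K A] (x y : A) (β v : K)
    (m : ℕ) :
    iterSkew x y β v (m + 1) = iterSkew x (x * y - β • (y * x)) (v * β) v m := by
  induction m with
  | zero => simp [iterSkew]
  | succ m ih =>
    rw [iterSkew, ih, iterSkew, pow_succ, mul_assoc]

theorem qbinom_eq_zero {K : Type} [CommRing K] (v : K) {m k : ℕ} (h : m < k) :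
    qbinom v m k = 0 := by
  induction m generalizing k with
  | zero =>
    obtain ⟨k, rfl⟩ := Nat.exists_eq_succ_of_ne_zero h.ne'
    simp [qbinom]
  | succ m ih =>
    obtain ⟨k, rfl⟩ := Nat.exists_eq_succ_of_ne_zero (Nat.ne_zero_of_lt h)
    simp [qbinom, ih (show m < k by omega), ih (show m < k + 1 by omega)]

theorem qbinom_zero_right {K : Type} [CommRing K] (v : K) (m : ℕ) : qbinom v m 0 = 1 := by
  cases m <;> rfl

theorem iterSkew_eq_sum {K A : Type} [Field K] [Ring A] [Algebra K A] (x y : A) (β v : K)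
    (m : ℕ) :
    iterSkew x y β v m = ∑ k ∈ Finset.range (m + 1),
      ((-1 : K) ^ k * qbinom v m k * (v ^ (k * (k - 1) / 2) * β ^ k)) •
        (x ^ (m - k) * y * x ^ k) := by
  induction m generalizing y β with
  | zero => simp [iterSkew, qbinom]
  | succ m ih =>
    have hterm : ∀ k ∈ Finset.range (m + 1),
        ((-1 : K) ^ k * qbinom v m k * (v ^ (k * (k - 1) / 2) * (v * β) ^ k)) •
          (x ^ (m - k) * (x * y - β • (y * x)) * x ^ k) =
        ((-1 : K) ^ k * qbinom v m k * (v ^ (k * (k - 1) / 2) * (v * β) ^ k)) •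
          (x ^ (m + 1 - k) * y * x ^ k) -
        ((-1 : K) ^ k * qbinom v m k * (v ^ (k * (k - 1) / 2) * (v * β) ^ k) * β) •
          (x ^ (m - k) * y * x ^ (k + 1)) := by
      intro k hk
      rw [Nat.succ_sub (Finset.mem_range_succ_iff.mp hk), pow_succ x (m - k), pow_succ' x k]
      simp only [mul_sub, sub_mul, smul_sub, mul_smul_comm, smul_mul_assoc, mul_assoc, smul_smul]
    have hext : ∑ k ∈ Finset.range (m + 1),
        ((-1 : K) ^ k * qbinom v m k * (v ^ (k * (k - 1) / 2) * (v * β) ^ k)) •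
          (x ^ (m + 1 - k) * y * x ^ k) =
        ∑ k ∈ Finset.range (m + 1 + 1),
        ((-1 : K) ^ k * qbinom v m k * (v ^ (k * (k - 1) / 2) * (v * β) ^ k)) •
          (x ^ (m + 1 - k) * y * x ^ k) := by
      rw [Finset.sum_range_succ _ (m + 1), qbinom_eq_zero v (Nat.lt_succ_self m)]
      simp
    rw [iterSkew_succ', ih, Finset.sum_congr rfl hterm, Finset.sum_sub_distrib, hext,
      Finset.sum_range_succ' _ (m + 1), Finset.sum_range_succ' _ (m + 1), add_sub_right_comm,
      ← Finset.sum_sub_distrib]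
    congr 1
    · refine Finset.sum_congr rfl fun k _ => ?_
      rw [Nat.add_sub_add_right m 1 k, ← sub_smul, qbinom]
      congr 1
      have hk : (k + 1) * (k + 1 - 1) / 2 = k * (k - 1) / 2 + k := by
        rw [← Finset.sum_range_id, ← Finset.sum_range_id, Finset.sum_range_succ]
      rw [hk]
      ring
    · simp [qbinom_zero_right]

theorem smul_comm_iterSkew {K A : Type} [Field K] [Ring A] [Algebra K A] {x y w : A}
    (β v : K) {p q : K} (hx : w * x = p • (x * w)) (hy : w * y = q • (y * w)) (k : ℕ) :
    w * iterSkew x y β v k = (p ^ k * q) • (iterSkew x y β v k * w) := by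
  induction k with
  | zero => simpa [iterSkew] using hy
  | succ k ih =>
    have h₁ : w * (x * iterSkew x y β v k) =
        (p ^ (k + 1) * q) • (x * iterSkew x y β v k * w) := by
      rw [← mul_assoc, hx, smul_mul_assoc, mul_assoc, ih, mul_smul_comm, smul_smul, ← mul_assoc x]
      ring_nf
    have h₂ : w * (iterSkew x y β v k * x) =
        (p ^ (k + 1) * q) • (iterSkew x y β v k * x * w) := by
      rw [← mul_assoc, ih, smul_mul_assoc, mul_assoc, hx, mul_smul_comm, smul_smul, ← mul_assoc]
      ring_nf
    rw [iterSkew, mul_sub, mul_smul_comm, h₁, h₂, sub_mul, smul_sub, smul_mul_assoc,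
      smul_comm]

theorem iterSkew_commutator {K A : Type} [Field K] [Ring A] [Algebra K A] {x y f w w' : A}
    {β β' v c : K} (hv : v ≠ 0) (hwx : w * x = v • (x * w)) (hwy : w * y = β • (y * w))
    (hwx' : w' * x = v⁻¹ • (x * w')) (hwy' : w' * y = β' • (y * w'))
    (hxf : x * f - f * x = c • (w - w')) (hyf : y * f = f * y) (k : ℕ) :
    iterSkew x y β v (k + 1) * f - f * iterSkew x y β v (k + 1) =
      (c * ∑ l ∈ Finset.range (k + 1), (v ^ l * β - v⁻¹ ^ l * β')) •
        (iterSkew x y β v k * w') := by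
  have hstep : ∀ k, iterSkew x y β v (k + 1) * f - f * iterSkew x y β v (k + 1) =
      x * (iterSkew x y β v k * f - f * iterSkew x y β v k) -
        (v ^ k * β) • ((iterSkew x y β v k * f - f * iterSkew x y β v k) * x) +
        (c * (v ^ k * β - v⁻¹ ^ k * β')) • (iterSkew x y β v k * w') := by
    intro k
    have hw := smul_comm_iterSkew β v hwx hwy k
    have hw' := smul_comm_iterSkew β v hwx' hwy' k
    rw [iterSkew]
    generalize iterSkew x y β v k = z at *
    have hxf' : x * f = f * x + c • (w - w') := by rw [← hxf]; abel
    have h₁ : f * (x * z) = x * (f * z) - c • (w * z - w' * z) := by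
      rw [← mul_assoc, ← mul_assoc, hxf', add_mul, smul_mul_assoc, sub_mul]; abel
    have h₂ : z * x * f = z * f * x + c • (z * w - z * w') := by
      rw [mul_assoc, hxf', mul_add, mul_smul_comm, mul_sub, mul_assoc]
    rw [sub_mul, mul_sub, smul_mul_assoc, h₂, h₁, hw, hw']
    simp only [mul_sub, sub_mul, mul_smul_comm, mul_assoc]
    module
  induction k with
  | zero =>
    rw [hstep]
    simp [iterSkew, hyf]
  | succ k ih =>
    have h : iterSkew x y β v k * w' * x = v⁻¹ • (iterSkew x y β v k * x * w') := by
      rw [mul_assoc, hwx', mul_smul_comm, mul_assoc]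
    rw [hstep, ih, smul_mul_assoc, h, Finset.sum_range_succ _ (k + 1), mul_add, add_smul]
    congr 1
    conv_rhs => rw [iterSkew]
    rw [sub_mul, smul_mul_assoc, mul_smul_comm, ← mul_assoc]
    have h' : v ^ (k + 1) * β * v⁻¹ = v ^ k * β := by field_simp; ring
    rw [← h']
    module

theorem iterSkew_commutator_eq_zero {K A : Type} [Field K] [Ring A] [Algebra K A]
    {x y f w w' : A} {β β' v c : K} {p : ℕ} (hv : v ≠ 0) (hβ : β * v ^ p = β')
    (hwx : w * x = v • (x * w)) (hwy : w * y = β • (y * w))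
    (hwx' : w' * x = v⁻¹ • (x * w')) (hwy' : w' * y = β' • (y * w'))
    (hxf : x * f - f * x = c • (w - w')) (hyf : y * f = f * y) :
    iterSkew x y β v (p + 1) * f = f * iterSkew x y β v (p + 1) := by
  rw [← sub_eq_zero, iterSkew_commutator hv hwx hwy hwx' hwy' hxf hyf]
  have : ∑ l ∈ Finset.range (p + 1), (v ^ l * β - v⁻¹ ^ l * β') = 0 := by
    rw [Finset.sum_sub_distrib, ← Finset.sum_range_reflect, sub_eq_zero]
    refine Finset.sum_congr rfl fun l hl => ?_
    have hl' : l ≤ p := Finset.mem_range_succ_iff.mp hl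
    rw [Nat.add_sub_cancel, ← hβ, inv_pow, pow_sub₀ v hv hl']
    ring
  rw [this, mul_zero, zero_smul]

theorem iterSkew_commutator_eq_zero_of_right {K A : Type} [Field K] [Ring A] [Algebra K A]
    {x y f w w' : A} {β θ θ' v c : K} {p : ℕ} (hθ : v ^ p * (β * θ) = 1) (hθ' : β * θ' = 1)
    (hwx : w * x = θ • (x * w)) (hwx' : w' * x = θ' • (x * w'))
    (hyf : y * f - f * y = c • (w - w')) (hxf : x * f = f * x) :
    iterSkew x y β v (p + 1) * f = f * iterSkew x y β v (p + 1) := by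
  have hstep : ∀ k, iterSkew x y β v (k + 1) * f - f * iterSkew x y β v (k + 1) =
      x * (iterSkew x y β v k * f - f * iterSkew x y β v k) -
        (v ^ k * β) • ((iterSkew x y β v k * f - f * iterSkew x y β v k) * x) := by
    intro k
    rw [iterSkew]
    generalize iterSkew x y β v k = z
    have hxf' : ∀ u, x * (f * u) = f * (x * u) := fun u => by rw [← mul_assoc, hxf, mul_assoc]
    simp only [mul_sub, sub_mul, smul_mul_assoc, mul_smul_comm, mul_assoc, hxf, hxf']
    module
  have hform : ∀ k, iterSkew x y β v (k + 1) * f - f * iterSkew x y β v (k + 1) =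
      (c * ∏ l ∈ Finset.range (k + 1), (1 - v ^ l * (β * θ))) • (x ^ (k + 1) * w) := by
    intro k
    induction k with
    | zero =>
      rw [hstep]
      simp only [iterSkew, hyf]
      rw [mul_smul_comm, smul_mul_assoc, mul_sub, sub_mul, hwx, hwx']
      have : x * w' = (β * θ') • (x * w') := by rw [hθ', one_smul]
      rw [this]
      simp only [hθ', Finset.prod_range_succ, Finset.prod_range_zero, pow_zero, zero_add, pow_one,
        one_mul, one_smul, smul_sub, smul_smul]
      have h2 : β * (c * θ') = c := by rw [mul_left_comm, hθ', mul_one]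
      rw [h2]
      module
    | succ k ih =>
      rw [hstep, ih, smul_mul_assoc, mul_assoc _ w x, hwx, mul_smul_comm, mul_smul_comm,
        ← mul_assoc, ← mul_assoc, ← pow_succ, ← pow_succ', Finset.prod_range_succ _ (k + 1)]
      module
  rw [← sub_eq_zero, hform, Finset.prod_range_succ, hθ]
  simp

/-- The scalar by which `ω_i` skew commutes with `e_j`. -/
def omegaChar {K : Type} [Field K] {n : ℕ} (a : Fin n → Fin n → ℤ) (d : Fin n → ℤ) (r s : K)
    (i j : Fin n) : K := r ^ eulB a d j i * (s ^ eulB a d i j)⁻¹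

/-- The scalar by which `ω_i'` skew commutes with `e_j`. -/
def omegaChar' {K : Type} [Field K] {n : ℕ} (a : Fin n → Fin n → ℤ) (d : Fin n → ℤ) (r s : K)
    (i j : Fin n) : K := (r ^ eulB a d i j)⁻¹ * s ^ eulB a d j i

theorem serreElt_eq_iterSkew {K : Type} [Field K] {n : ℕ} (a : Fin n → Fin n → ℤ)
    (d : Fin n → ℤ) (r s : K) {A : Type} [Ring A] [Algebra K A] (E : Fin n → A) (i j : Fin n) :
    serreElt a d r s E i j = iterSkew (E i) (E j) (omegaChar a d r s i j)
      (r ^ d i * (s ^ d i)⁻¹) (1 - a i j).toNat := by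
  rw [iterSkew_eq_sum, serreElt]
  refine Finset.sum_congr rfl fun k _ => ?_
  rw [ccoef, omegaChar, mul_pow (r ^ eulB a d j i), inv_pow, mul_comm (k : ℤ),
    mul_comm (k : ℤ), zpow_mul, zpow_mul, zpow_natCast, zpow_natCast]
  simp only [mul_assoc]

theorem eulB_add_eulB {n : ℕ} {a : Fin n → Fin n → ℤ} {d : Fin n → ℤ}
    (hsym : ∀ i j, d i * a i j = d j * a j i) {i j : Fin n} (h : i ≠ j) :
    eulB a d i j + eulB a d j i = d i * a i j := by
  rcases lt_or_gt_of_ne h with h' | h'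
  · simp [eulB, h', h'.not_gt, h.symm]
  · simp [eulB, h', h'.not_gt, h, hsym i j]

/-- Relations (R2) and (R4) make the Serre elements in the `E_i` commute with every `F_k`. -/
theorem serreElt_commute {K : Type} [Field K] {n : ℕ} {a : Fin n → Fin n → ℤ} {d : Fin n → ℤ}
    {r s : K} (hr : r ≠ 0) (hs : s ≠ 0) (hoff : ∀ i j, i ≠ j → a i j ≤ 0)
    (hsym : ∀ i j, d i * a i j = d j * a j i) {A : Type} [Ring A] [Algebra K A]
    {E F W W' : Fin n → A} {c : Fin n → K}
    (hW : ∀ i j, W i * E j = omegaChar a d r s i j • (E j * W i))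
    (hW' : ∀ i j, W' i * E j = omegaChar' a d r s i j • (E j * W' i))
    (hEF : ∀ i j, E i * F j - F j * E i = if i = j then c i • (W i - W' i) else 0)
    {i j : Fin n} (hij : i ≠ j) (k : Fin n) :
    serreElt a d r s E i j * F k = F k * serreElt a d r s E i j := by
  have hv : r ^ d i * (s ^ d i)⁻¹ ≠ 0 := mul_ne_zero (zpow_ne_zero _ hr)
    (inv_ne_zero (zpow_ne_zero _ hs))
  obtain ⟨p, hp⟩ := Int.eq_ofNat_of_zero_le (neg_nonneg.mpr (hoff i j hij))
  have hm : (1 - a i j).toNat = p + 1 := by omega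
  have hvp : (r ^ d i * (s ^ d i)⁻¹) ^ p =
      (r ^ (eulB a d i j + eulB a d j i))⁻¹ * s ^ (eulB a d i j + eulB a d j i) := by
    rw [eulB_add_eulB hsym hij, show a i j = -(p : ℤ) by omega, mul_neg, zpow_neg, zpow_neg,
      inv_inv, zpow_mul, zpow_mul, zpow_natCast, zpow_natCast, mul_pow, inv_pow]
  have hcomm : ∀ {i j}, i ≠ j → E i * F j = F j * E i := fun {i j} h => by
    rw [← sub_eq_zero, hEF, if_neg h]
  have hr' := fun m : ℤ => zpow_ne_zero m hr
  have hs' := fun m : ℤ => zpow_ne_zero m hs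
  rw [serreElt_eq_iterSkew, hm]
  by_cases hki : k = i
  · subst hki
    have hc : omegaChar a d r s k k = r ^ d k * (s ^ d k)⁻¹ := by simp [omegaChar, eulB]
    have hc' : omegaChar' a d r s k k = (r ^ d k * (s ^ d k)⁻¹)⁻¹ := by
      simp [omegaChar', eulB, mul_comm]
    refine iterSkew_commutator_eq_zero hv ?_ (hc ▸ hW k k) (hW k j) (hc' ▸ hW' k k) (hW' k j)
      (c := c k) (by rw [hEF, if_pos rfl]) (hcomm hij.symm)
    rw [hvp, omegaChar, omegaChar', zpow_add₀ hr, zpow_add₀ hs]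
    field_simp [hr', hs']
  by_cases hkj : k = j
  · subst hkj
    refine iterSkew_commutator_eq_zero_of_right ?_ ?_ (hW k i) (hW' k i)
      (c := c k) (by rw [hEF, if_pos rfl]) (hcomm hij)
    · rw [hvp, omegaChar, omegaChar, zpow_add₀ hr, zpow_add₀ hs]
      field_simp [hr', hs']
    · rw [omegaChar, omegaChar']
      field_simp [hr', hs']
  · have hki' := hcomm (Ne.symm hki)
    have hkj' := hcomm (Ne.symm hkj)
    have key : ∀ m, Commute (iterSkew (E i) (E j) (omegaChar a d r s i j)
        (r ^ d i * (s ^ d i)⁻¹) m) (F k) := by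
      intro m
      induction m with
      | zero => exact hkj'
      | succ m ih =>
        exact (Commute.mul_left hki' ih).sub_left ((ih.mul_left hki').smul_left _)
    exact key _

/-- The negative Serre element is the positive one of the opposite algebra. -/
theorem op_serreEltF {K : Type} [Field K] {n : ℕ} (a : Fin n → Fin n → ℤ) (d : Fin n → ℤ)
    (r s : K) {A : Type} [Ring A] [Algebra K A] (F : Fin n → A) (i j : Fin n) :
    MulOpposite.op (serreEltF a d r s F i j) =
      serreElt a d r s (fun k => MulOpposite.op (F k)) i j := by
  simp [serreElt, serreEltF, Finset.op_sum, mul_assoc]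

theorem map_serreElt {K : Type} [Field K] {n : ℕ} (a : Fin n → Fin n → ℤ) (d : Fin n → ℤ)
    (r s : K) {A B : Type} [Ring A] [Algebra K A] [Ring B] [Algebra K B] (φ : A →ₐ[K] B)
    (E : Fin n → A) (i j : Fin n) :
    φ (serreElt a d r s E i j) = serreElt a d r s (fun k => φ (E k)) i j := by
  simp [serreElt]

theorem map_serreEltF {K : Type} [Field K] {n : ℕ} (a : Fin n → Fin n → ℤ) (d : Fin n → ℤ)
    (r s : K) {A B : Type} [Ring A] [Algebra K A] [Ring B] [Algebra K B] (φ : A →ₐ[K] B)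
    (F : Fin n → A) (i j : Fin n) :
    φ (serreEltF a d r s F i j) = serreEltF a d r s (fun k => φ (F k)) i j := by
  simp [serreEltF]

/-- The vector space with basis the words in `Fin n`. -/
def WordModule (K : Type) [Field K] (n : ℕ) : Type := List (Fin n) →₀ K

instance (K : Type) [Field K] (n : ℕ) : AddCommGroup (WordModule K n) :=
  inferInstanceAs (AddCommGroup (List (Fin n) →₀ K))

instance (K : Type) [Field K] (n : ℕ) : Module K (WordModule K n) :=
  inferInstanceAs (Module K (List (Fin n) →₀ K))

/-- The basis of words. -/
def wordBasis (K : Type) [Field K] (n : ℕ) : Module.Basis (List (Fin n)) K (WordModule K n) :=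
  Finsupp.basisSingleOne

/-- Left multiplication by the letter `j` on words: the action of `e_j`. -/
def consOp {K : Type} [Field K] {n : ℕ} (j : Fin n) : Module.End K (WordModule K n) :=
  (wordBasis K n).constr K fun w => wordBasis K n (j :: w)

/-- The diagonal operator scaling each word `w` by `t * ∏_{j ∈ w} χ j`. -/
def charOp {K : Type} [Field K] {n : ℕ} (t : K) (χ : Fin n → K) :
    Module.End K (WordModule K n) :=
  (wordBasis K n).constr K fun w => (t * (w.map χ).prod) • wordBasis K n w

/-- The action of `f_i` on words, determined by relation (R4) and `f_i · [] = 0`. -/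
def lowerWord {K : Type} [Field K] {n : ℕ} (a : Fin n → Fin n → ℤ) (d : Fin n → ℤ) (r s t : K)
    (i : Fin n) : List (Fin n) → WordModule K n
  | [] => 0
  | j :: w => consOp j (lowerWord a d r s t i w) -
      if i = j then (r ^ d i - s ^ d i)⁻¹ •
        (charOp 1 (omegaChar a d r s i) - charOp t (omegaChar' a d r s i))
          (wordBasis K n w) else 0

/-- The linear extension of `lowerWord`. -/
def lowerOp {K : Type} [Field K] {n : ℕ} (a : Fin n → Fin n → ℤ) (d : Fin n → ℤ) (r s t : K)
    (i : Fin n) : Module.End K (WordModule K n) :=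
  (wordBasis K n).constr K (lowerWord a d r s t i)

theorem consOp_single {K : Type} [Field K] {n : ℕ} (j : Fin n) (w : List (Fin n)) :
    consOp j (wordBasis K n w) = wordBasis K n (j :: w) := by
  simp [consOp]

theorem charOp_single {K : Type} [Field K] {n : ℕ} (t : K) (χ : Fin n → K)
    (w : List (Fin n)) :
    charOp t χ (wordBasis K n w) = (t * (w.map χ).prod) • wordBasis K n w := by
  simp [charOp]

theorem charOp_mul_charOp {K : Type} [Field K] {n : ℕ} (t t' : K) (χ χ' : Fin n → K) :
    charOp t χ * charOp t' χ' = charOp (t * t') (χ * χ') := by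
  refine (wordBasis K n).ext fun w => ?_
  rw [Module.End.mul_apply, charOp_single, map_smul, charOp_single, charOp_single, smul_smul,
    show (χ * χ') = fun k => χ k * χ' k from rfl, List.prod_map_mul]
  congr 1
  ring

theorem charOp_one_one {K : Type} [Field K] {n : ℕ} :
    charOp (1 : K) (1 : Fin n → K) = 1 := by
  refine (wordBasis K n).ext fun w => ?_
  simp [charOp_single, List.prod_eq_one]

theorem charOp_mul_consOp {K : Type} [Field K] {n : ℕ} (t : K) (χ : Fin n → K) (j : Fin n) :
    charOp t χ * consOp j = χ j • (consOp j * charOp t χ) := by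
  refine (wordBasis K n).ext fun w => ?_
  rw [Module.End.mul_apply, consOp_single, charOp_single, LinearMap.smul_apply,
    Module.End.mul_apply, charOp_single, map_smul, consOp_single, smul_smul, List.map_cons,
    List.prod_cons]
  congr 1
  ring

theorem charOp_eq_smul {K : Type} [Field K] {n : ℕ} (t : K) (χ : Fin n → K) :
    charOp t χ = t • charOp 1 χ := by
  refine (wordBasis K n).ext fun w => ?_
  rw [LinearMap.smul_apply, charOp_single, charOp_single, smul_smul, one_mul]

theorem charOp_mul_inv {K : Type} [Field K] {n : ℕ} {t : K} (ht : t ≠ 0) {χ : Fin n → K}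
    (hχ : ∀ j, χ j ≠ 0) : charOp t χ * charOp t⁻¹ χ⁻¹ = 1 := by
  have : χ * χ⁻¹ = 1 := funext fun j => mul_inv_cancel₀ (hχ j)
  rw [charOp_mul_charOp, mul_inv_cancel₀ ht, this, charOp_one_one]

theorem charOp_inv_mul {K : Type} [Field K] {n : ℕ} {t : K} (ht : t ≠ 0) {χ : Fin n → K}
    (hχ : ∀ j, χ j ≠ 0) : charOp t⁻¹ χ⁻¹ * charOp t χ = 1 := by
  rw [charOp_mul_charOp, mul_comm t⁻¹, mul_comm χ⁻¹, ← charOp_mul_charOp, charOp_mul_inv ht hχ]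

theorem omegaChar_ne_zero {K : Type} [Field K] {n : ℕ} (a : Fin n → Fin n → ℤ)
    (d : Fin n → ℤ) {r s : K} (hr : r ≠ 0) (hs : s ≠ 0) (i j : Fin n) :
    omegaChar a d r s i j ≠ 0 :=
  mul_ne_zero (zpow_ne_zero _ hr) (inv_ne_zero (zpow_ne_zero _ hs))

theorem omegaChar'_ne_zero {K : Type} [Field K] {n : ℕ} (a : Fin n → Fin n → ℤ)
    (d : Fin n → ℤ) {r s : K} (hr : r ≠ 0) (hs : s ≠ 0) (i j : Fin n) :
    omegaChar' a d r s i j ≠ 0 :=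
  mul_ne_zero (inv_ne_zero (zpow_ne_zero _ hr)) (zpow_ne_zero _ hs)

theorem lowerOp_nil {K : Type} [Field K] {n : ℕ} (a : Fin n → Fin n → ℤ) (d : Fin n → ℤ)
    (r s t : K) (i : Fin n) : lowerOp a d r s t i (wordBasis K n []) = 0 := by
  simp [lowerOp, lowerWord]

theorem consOp_lowerOp_commutator {K : Type} [Field K] {n : ℕ} (a : Fin n → Fin n → ℤ)
    (d : Fin n → ℤ) (r s t : K) (i j : Fin n) :
    consOp i * lowerOp a d r s t j - lowerOp a d r s t j * consOp i =
      if i = j then (r ^ d i - s ^ d i)⁻¹ •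
        (charOp 1 (omegaChar a d r s i) - charOp t (omegaChar' a d r s i)) else 0 := by
  refine (wordBasis K n).ext fun w => ?_
  rw [LinearMap.sub_apply, Module.End.mul_apply, Module.End.mul_apply, consOp_single, lowerOp,
    Module.Basis.constr_basis, Module.Basis.constr_basis, lowerWord,
    sub_sub_cancel]
  by_cases h : i = j
  · subst h
    simp
  · simp [h, Ne.symm h]

theorem lowerOp_mul_consOp {K : Type} [Field K] {n : ℕ} (a : Fin n → Fin n → ℤ)
    (d : Fin n → ℤ) (r s t : K) (i j : Fin n) :
    lowerOp a d r s t i * consOp j = consOp j * lowerOp a d r s t i -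
      if j = i then (r ^ d j - s ^ d j)⁻¹ •
        (charOp 1 (omegaChar a d r s j) - charOp t (omegaChar' a d r s j)) else 0 := by
  rw [← consOp_lowerOp_commutator, sub_sub_cancel]

theorem charOp_mul_lowerOp {K : Type} [Field K] {n : ℕ} (a : Fin n → Fin n → ℤ)
    (d : Fin n → ℤ) (r s t u : K) {χ : Fin n → K} (hχ : ∀ j, χ j ≠ 0) (i : Fin n) :
    charOp u χ * lowerOp a d r s t i = (χ i)⁻¹ • (lowerOp a d r s t i * charOp u χ) := by
  refine (wordBasis K n).ext fun w => ?_
  induction w with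
  | nil =>
    rw [LinearMap.smul_apply, Module.End.mul_apply, Module.End.mul_apply, lowerOp_nil,
      charOp_single, map_smul, lowerOp_nil]
    simp
  | cons j w ih =>
    rw [← consOp_single]
    simp only [← Module.End.mul_apply] at ih ⊢
    have hcomm : ∀ (y : K) (ψ : Fin n → K), charOp u χ * charOp y ψ = charOp y ψ * charOp u χ :=
      fun y ψ => by rw [charOp_mul_charOp, charOp_mul_charOp, mul_comm u, mul_comm χ]
    have hL : charOp u χ * lowerOp a d r s t i * consOp j =
        χ j • (consOp j * (charOp u χ * lowerOp a d r s t i)) -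
          (if j = i then (r ^ d j - s ^ d j)⁻¹ •
            (charOp 1 (omegaChar a d r s j) - charOp t (omegaChar' a d r s j)) else 0) *
            charOp u χ := by
      rw [mul_assoc, lowerOp_mul_consOp, mul_sub, ← mul_assoc, charOp_mul_consOp, smul_mul_assoc,
        mul_assoc]
      congr 1
      split_ifs
      · rw [mul_smul_comm, mul_sub, hcomm, hcomm, smul_mul_assoc, sub_mul]
      · simp
    have hR : (χ i)⁻¹ • (lowerOp a d r s t i * charOp u χ) * consOp j =
        χ j • (consOp j * ((χ i)⁻¹ • (lowerOp a d r s t i * charOp u χ))) -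
          (if j = i then (r ^ d j - s ^ d j)⁻¹ •
            (charOp 1 (omegaChar a d r s j) - charOp t (omegaChar' a d r s j)) else 0) *
            charOp u χ := by
      rw [smul_mul_assoc, mul_assoc, charOp_mul_consOp, mul_smul_comm, ← mul_assoc,
        lowerOp_mul_consOp, sub_mul, smul_sub, smul_sub, mul_smul_comm, mul_assoc,
        smul_comm (χ j)]
      congr 1
      split_ifs with h
      · rw [h, smul_smul, inv_mul_cancel₀ (hχ i), one_smul]
      · simp
    rw [hL, hR, LinearMap.sub_apply, LinearMap.sub_apply, LinearMap.smul_apply,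
      LinearMap.smul_apply, Module.End.mul_apply, ih, Module.End.mul_apply, Module.End.mul_apply]

theorem serreElt_consOp_commute {K : Type} [Field K] {n : ℕ} {a : Fin n → Fin n → ℤ}
    {d : Fin n → ℤ} {r s : K} (hr : r ≠ 0) (hs : s ≠ 0) (hoff : ∀ i j, i ≠ j → a i j ≤ 0)
    (hsym : ∀ i j, d i * a i j = d j * a j i) (t : K) {i j : Fin n} (hij : i ≠ j) (k : Fin n) :
    serreElt a d r s consOp i j * lowerOp a d r s t k =
      lowerOp a d r s t k * serreElt a d r s consOp i j :=
  serreElt_commute hr hs hoff hsym (fun _ _ => charOp_mul_consOp _ _ _)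
    (fun _ _ => charOp_mul_consOp _ _ _)
    (fun i j => consOp_lowerOp_commutator a d r s t i j) hij k

theorem serreEltF_lowerOp {K : Type} [Field K] {n : ℕ} {a : Fin n → Fin n → ℤ}
    {d : Fin n → ℤ} {r s : K} (hr : r ≠ 0) (hs : s ≠ 0) (hoff : ∀ i j, i ≠ j → a i j ≤ 0)
    (hsym : ∀ i j, d i * a i j = d j * a j i) (t : K) {i j : Fin n} (hij : i ≠ j) :
    serreEltF a d r s (lowerOp a d r s t) i j = 0 := by
  have hop : ∀ (u : K) (χ : Fin n → K) (k : Fin n), (∀ j, χ j ≠ 0) →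
      MulOpposite.op (charOp u χ) * MulOpposite.op (lowerOp a d r s t k) =
        χ k • (MulOpposite.op (lowerOp a d r s t k) * MulOpposite.op (charOp u χ)) := by
    intro u χ k hχ
    rw [← MulOpposite.op_mul, ← MulOpposite.op_mul, ← MulOpposite.op_smul,
      charOp_mul_lowerOp a d r s t u hχ, smul_smul, mul_inv_cancel₀ (hχ k), one_smul]
  have hcomm : ∀ k, serreEltF a d r s (lowerOp a d r s t) i j * consOp k =
      consOp k * serreEltF a d r s (lowerOp a d r s t) i j := by
    intro k
    apply MulOpposite.op_injective
    rw [MulOpposite.op_mul, MulOpposite.op_mul, op_serreEltF]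
    refine (serreElt_commute hr hs hoff hsym (F := fun k => MulOpposite.op (consOp k))
      (W := fun i => MulOpposite.op (charOp 1 (omegaChar a d r s i)))
      (W' := fun i => MulOpposite.op (charOp t (omegaChar' a d r s i)))
      (c := fun i => (r ^ d i - s ^ d i)⁻¹)
      (fun i j => hop _ _ _ (omegaChar_ne_zero a d hr hs i))
      (fun i j => hop _ _ _ (omegaChar'_ne_zero a d hr hs i)) (fun k l => ?_) hij k).symm
    rw [← MulOpposite.op_mul, ← MulOpposite.op_mul, ← MulOpposite.op_sub,
      consOp_lowerOp_commutator]
    by_cases h : k = l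
    · subst h
      simp
    · simp [h, Ne.symm h]
  have hnil : serreEltF a d r s (lowerOp a d r s t) i j (wordBasis K n []) = 0 := by
    rw [serreEltF, LinearMap.sum_apply]
    refine Finset.sum_eq_zero fun k hk => ?_
    rw [LinearMap.smul_apply]
    rcases Nat.eq_zero_or_pos ((1 - a i j).toNat - k) with h | h
    · rw [h, pow_zero, mul_one, Module.End.mul_apply, lowerOp_nil, map_zero, smul_zero]
    · obtain ⟨m, hm⟩ := Nat.exists_eq_succ_of_ne_zero h.ne'
      rw [hm, pow_succ, ← mul_assoc, Module.End.mul_apply, lowerOp_nil, map_zero, smul_zero]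
  refine (wordBasis K n).ext fun w => ?_
  induction w with
  | nil => exact hnil
  | cons k w ih =>
    rw [← consOp_single, ← Module.End.mul_apply, hcomm, Module.End.mul_apply, ih]
    simp

theorem exists_charOp_mul_serreElt {K : Type} [Field K] {n : ℕ} (a : Fin n → Fin n → ℤ)
    (d : Fin n → ℤ) (r s : K) (t : K) (χ : Fin n → K) (i j : Fin n) :
    ∃ c : K, charOp t χ * serreElt a d r s consOp i j =
      c • (serreElt a d r s consOp i j * charOp t χ) := by
  rw [serreElt_eq_iterSkew]
  exact ⟨_, smul_comm_iterSkew _ _ (charOp_mul_consOp t χ i) (charOp_mul_consOp t χ j) _⟩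

/-- The subspace of the word module spanned by the two-sided ideal of Serre elements. -/
def serreSubmodule {K : Type} [Field K] {n : ℕ} (a : Fin n → Fin n → ℤ) (d : Fin n → ℤ)
    (r s : K) : Submodule K (WordModule K n) :=
  Submodule.span K {x | ∃ (u : List (Fin n)) (i j : Fin n) (v : WordModule K n), i ≠ j ∧
    x = (u.map consOp).prod (serreElt a d r s consOp i j v)}

theorem serreSubmodule_induction {K : Type} [Field K] {n : ℕ} {a : Fin n → Fin n → ℤ}
    {d : Fin n → ℤ} {r s : K} {N : Submodule K (WordModule K n)}
    (hserre : ∀ (i j : Fin n) (v : WordModule K n), i ≠ j →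
      serreElt a d r s consOp i j v ∈ N)
    (hcons : ∀ k, ∀ x ∈ serreSubmodule a d r s, x ∈ N → consOp k x ∈ N) :
    serreSubmodule a d r s ≤ N := by
  refine Submodule.span_le.mpr ?_
  rintro _ ⟨u, i, j, v, hij, rfl⟩
  generalize hx : serreElt a d r s consOp i j v = x
  induction u with
  | nil =>
    rw [List.map_nil, List.prod_nil, Module.End.one_apply, ← hx]
    exact hserre i j v hij
  | cons k u ih =>
    rw [List.map_cons, List.prod_cons, Module.End.mul_apply]
    exact hcons k _ (Submodule.subset_span ⟨u, i, j, v, hij, by rw [hx]⟩) ih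

theorem serreElt_mem_serreSubmodule {K : Type} [Field K] {n : ℕ} (a : Fin n → Fin n → ℤ)
    (d : Fin n → ℤ) (r s : K) {i j : Fin n} (v : WordModule K n) (hij : i ≠ j) :
    serreElt a d r s consOp i j v ∈ serreSubmodule a d r s :=
  Submodule.subset_span ⟨[], i, j, v, hij, by
    rw [List.map_nil, List.prod_nil, Module.End.one_apply]⟩

theorem consOp_mem_serreSubmodule {K : Type} [Field K] {n : ℕ} {a : Fin n → Fin n → ℤ}
    {d : Fin n → ℤ} {r s : K} (k : Fin n) {x : WordModule K n}
    (hx : x ∈ serreSubmodule a d r s) : consOp k x ∈ serreSubmodule a d r s := by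
  revert x
  change serreSubmodule a d r s ≤ (serreSubmodule a d r s).comap (consOp k)
  refine Submodule.span_le.mpr ?_
  rintro _ ⟨u, i, j, v, hij, rfl⟩
  exact Submodule.subset_span ⟨k :: u, i, j, v, hij, by
    rw [List.map_cons, List.prod_cons, Module.End.mul_apply]⟩

theorem charOp_mem_serreSubmodule {K : Type} [Field K] {n : ℕ} {a : Fin n → Fin n → ℤ}
    {d : Fin n → ℤ} {r s : K} (t : K) (χ : Fin n → K) {x : WordModule K n}
    (hx : x ∈ serreSubmodule a d r s) : charOp t χ x ∈ serreSubmodule a d r s := by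
  refine serreSubmodule_induction (N := (serreSubmodule a d r s).comap (charOp t χ))
    (fun i j v hij => ?_) (fun k x _ ih => ?_) hx <;> rw [Submodule.mem_comap] at *
  · obtain ⟨c, hc⟩ := exists_charOp_mul_serreElt a d r s t χ i j
    have h : charOp t χ (serreElt a d r s consOp i j v) =
        c • serreElt a d r s consOp i j (charOp t χ v) := LinearMap.congr_fun hc v
    rw [h]
    exact Submodule.smul_mem _ _ (serreElt_mem_serreSubmodule a d r s _ hij)
  · have h : charOp t χ (consOp k x) = χ k • consOp k (charOp t χ x) :=
      LinearMap.congr_fun (charOp_mul_consOp t χ k) x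
    rw [h]
    exact Submodule.smul_mem _ _ (consOp_mem_serreSubmodule k ih)

theorem lowerOp_mem_serreSubmodule {K : Type} [Field K] {n : ℕ} {a : Fin n → Fin n → ℤ}
    {d : Fin n → ℤ} {r s : K} (hr : r ≠ 0) (hs : s ≠ 0) (hoff : ∀ i j, i ≠ j → a i j ≤ 0)
    (hsym : ∀ i j, d i * a i j = d j * a j i) (t : K) (k : Fin n) {x : WordModule K n}
    (hx : x ∈ serreSubmodule a d r s) : lowerOp a d r s t k x ∈ serreSubmodule a d r s := by
  refine serreSubmodule_induction (N := (serreSubmodule a d r s).comap (lowerOp a d r s t k))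
    (fun i j v hij => ?_) (fun l x hx ih => ?_) hx <;> rw [Submodule.mem_comap] at *
  · have h : serreElt a d r s consOp i j (lowerOp a d r s t k v) =
        lowerOp a d r s t k (serreElt a d r s consOp i j v) :=
      LinearMap.congr_fun (serreElt_consOp_commute hr hs hoff hsym t hij k) v
    rw [← h]
    exact serreElt_mem_serreSubmodule a d r s _ hij
  · have h := LinearMap.congr_fun (lowerOp_mul_consOp a d r s t k l) x
    rw [Module.End.mul_apply, LinearMap.sub_apply, Module.End.mul_apply] at h
    rw [h]
    refine Submodule.sub_mem _ (consOp_mem_serreSubmodule l ih) ?_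
    split_ifs
    · rw [LinearMap.smul_apply, LinearMap.sub_apply]
      exact Submodule.smul_mem _ _ (Submodule.sub_mem _
        (charOp_mem_serreSubmodule _ _ hx) (charOp_mem_serreSubmodule _ _ hx))
    · exact Submodule.zero_mem _

/-- The action of the generators of `U_{r,s}(𝔤)` on words, with `ω_i, ω_i'` acting on the
empty word by `1, t`. -/
def genOp {n : ℕ} (a : Fin n → Fin n → ℤ) (d : Fin n → ℤ) (t : K2) :
    Gen n → Module.End K2 (WordModule K2 n)
  | Gen.e i => consOp i
  | Gen.f i => lowerOp a d rr ss t i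
  | Gen.w i => charOp 1 (omegaChar a d rr ss i)
  | Gen.winv i => charOp 1 (omegaChar a d rr ss i)⁻¹
  | Gen.w' i => charOp t (omegaChar' a d rr ss i)
  | Gen.w'inv i => charOp t⁻¹ (omegaChar' a d rr ss i)⁻¹

theorem rr_ne_zero : rr ≠ 0 :=
  (map_ne_zero_iff _ (IsFractionRing.injective (MvPolynomial (Fin 2) ℚ) K2)).mpr
    (MvPolynomial.X_ne_zero 0)

theorem ss_ne_zero : ss ≠ 0 :=
  (map_ne_zero_iff _ (IsFractionRing.injective (MvPolynomial (Fin 2) ℚ) K2)).mpr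
    (MvPolynomial.X_ne_zero 1)

theorem genOp_mem_serreSubmodule {n : ℕ} {a : Fin n → Fin n → ℤ} {d : Fin n → ℤ}
    (hoff : ∀ i j, i ≠ j → a i j ≤ 0) (hsym : ∀ i j, d i * a i j = d j * a j i) (t : K2)
    (g : Gen n) {x : WordModule K2 n} (hx : x ∈ serreSubmodule a d rr ss) :
    genOp a d t g x ∈ serreSubmodule a d rr ss := by
  cases g with
  | e i => exact consOp_mem_serreSubmodule i hx
  | f i => exact lowerOp_mem_serreSubmodule rr_ne_zero ss_ne_zero hoff hsym t i hx
  | w i => exact charOp_mem_serreSubmodule _ _ hx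
  | winv i => exact charOp_mem_serreSubmodule _ _ hx
  | w' i => exact charOp_mem_serreSubmodule _ _ hx
  | w'inv i => exact charOp_mem_serreSubmodule _ _ hx

theorem exists_genOp_tor {n : ℕ} (a : Fin n → Fin n → ℤ) (d : Fin n → ℤ) (t : K2) (i : Fin n)
    (p q : Bool) : ∃ u χ, genOp a d t (tor i p q) = charOp u χ := by
  cases p <;> cases q <;> exact ⟨_, _, rfl⟩

theorem genOp_respects_rel {n : ℕ} {a : Fin n → Fin n → ℤ} {d : Fin n → ℤ}
    (hoff : ∀ i j, i ≠ j → a i j ≤ 0) (hsym : ∀ i j, d i * a i j = d j * a j i) {t : K2}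
    (ht : t ≠ 0) {x y : FreeAlgebra K2 (Gen n)} (hxy : URel a d x y) (v : WordModule K2 n) :
    FreeAlgebra.lift K2 (genOp a d t) x v - FreeAlgebra.lift K2 (genOp a d t) y v ∈
      serreSubmodule a d rr ss := by
  have of_eq : FreeAlgebra.lift K2 (genOp a d t) x = FreeAlgebra.lift K2 (genOp a d t) y →
      FreeAlgebra.lift K2 (genOp a d t) x v - FreeAlgebra.lift K2 (genOp a d t) y v ∈
        serreSubmodule a d rr ss := fun h => by
    rw [h, sub_self]
    exact Submodule.zero_mem _
  have h₁ := omegaChar_ne_zero a d rr_ne_zero ss_ne_zero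
  have h₁' := omegaChar'_ne_zero a d rr_ne_zero ss_ne_zero
  cases hxy with
  | torComm i j p q p' q' =>
    apply of_eq
    obtain ⟨u, χ, h⟩ := exists_genOp_tor a d t i p q
    obtain ⟨u', χ', h'⟩ := exists_genOp_tor a d t j p' q'
    rw [map_mul, map_mul, FreeAlgebra.lift_ι_apply, FreeAlgebra.lift_ι_apply, h, h',
      charOp_mul_charOp, charOp_mul_charOp, mul_comm u, mul_comm χ]
  | wInvR i =>
    apply of_eq
    rw [map_mul, map_one, FreeAlgebra.lift_ι_apply, FreeAlgebra.lift_ι_apply, genOp, genOp]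
    simpa only [inv_one] using charOp_mul_inv one_ne_zero (h₁ i)
  | wInvL i =>
    apply of_eq
    rw [map_mul, map_one, FreeAlgebra.lift_ι_apply, FreeAlgebra.lift_ι_apply, genOp, genOp]
    simpa only [inv_one] using charOp_inv_mul one_ne_zero (h₁ i)
  | w'InvR i =>
    apply of_eq
    rw [map_mul, map_one, FreeAlgebra.lift_ι_apply, FreeAlgebra.lift_ι_apply, genOp, genOp]
    exact charOp_mul_inv ht (h₁' i)
  | w'InvL i =>
    apply of_eq
    rw [map_mul, map_one, FreeAlgebra.lift_ι_apply, FreeAlgebra.lift_ι_apply, genOp, genOp]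
    exact charOp_inv_mul ht (h₁' i)
  | we i j =>
    apply of_eq
    rw [map_smul, map_mul, map_mul, FreeAlgebra.lift_ι_apply, FreeAlgebra.lift_ι_apply, genOp,
      genOp, charOp_mul_consOp, omegaChar]
  | w'e i j =>
    apply of_eq
    rw [map_smul, map_mul, map_mul, FreeAlgebra.lift_ι_apply, FreeAlgebra.lift_ι_apply, genOp,
      genOp, charOp_mul_consOp, omegaChar']
  | wf i j =>
    apply of_eq
    rw [map_smul, map_mul, map_mul, FreeAlgebra.lift_ι_apply, FreeAlgebra.lift_ι_apply, genOp,
      genOp, charOp_mul_lowerOp a d rr ss t 1 (h₁ i), omegaChar, mul_inv, inv_inv]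
  | w'f i j =>
    apply of_eq
    rw [map_smul, map_mul, map_mul, FreeAlgebra.lift_ι_apply, FreeAlgebra.lift_ι_apply, genOp,
      genOp, charOp_mul_lowerOp a d rr ss t t (h₁' i), omegaChar', mul_inv, inv_inv]
  | ef i j =>
    apply of_eq
    rw [map_sub, map_mul, map_mul, FreeAlgebra.lift_ι_apply, FreeAlgebra.lift_ι_apply, genOp,
      genOp, consOp_lowerOp_commutator]
    split_ifs
    · rw [map_smul, map_sub, FreeAlgebra.lift_ι_apply, FreeAlgebra.lift_ι_apply, genOp, genOp]
    · rw [map_zero]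
  | serreE i j h =>
    rw [map_serreElt, map_zero, LinearMap.zero_apply, sub_zero]
    simp only [FreeAlgebra.lift_ι_apply, genOp]
    exact serreElt_mem_serreSubmodule a d rr ss v h
  | serreF i j h =>
    apply of_eq
    rw [map_serreEltF, map_zero]
    simp only [FreeAlgebra.lift_ι_apply, genOp]
    exact serreEltF_lowerOp rr_ne_zero ss_ne_zero hoff hsym t h

/-- The lowest weight Verma modules of `U_{r,s}(𝔤)`, realised on a quotient of the word
module. -/
theorem exists_verma_representation {n : ℕ} {a : Fin n → Fin n → ℤ} {d : Fin n → ℤ}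
    (hoff : ∀ i j, i ≠ j → a i j ≤ 0) (hsym : ∀ i j, d i * a i j = d j * a j i) {t : K2}
    (ht : t ≠ 0) :
    ∃ ρ : Uq a d →ₐ[K2] Module.End K2 (WordModule K2 n ⧸ serreSubmodule a d rr ss),
      ∀ g v, ρ (gU a d g) (Submodule.Quotient.mk v) =
        Submodule.Quotient.mk (genOp a d t g v) := by
  let ψ := FreeAlgebra.lift K2 fun g =>
    (serreSubmodule a d rr ss).mapQ (serreSubmodule a d rr ss) (genOp a d t g)
      fun _ hx => genOp_mem_serreSubmodule hoff hsym t g hx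
  have hψ : ∀ x v, ψ x (Submodule.Quotient.mk v) =
      Submodule.Quotient.mk (FreeAlgebra.lift K2 (genOp a d t) x v) := by
    intro x
    induction x using FreeAlgebra.induction with
    | grade0 c =>
      intro v
      rw [AlgHom.commutes, AlgHom.commutes, Module.algebraMap_end_apply,
        Module.algebraMap_end_apply, Submodule.Quotient.mk_smul]
    | grade1 g =>
      intro v
      rw [FreeAlgebra.lift_ι_apply, FreeAlgebra.lift_ι_apply]
      exact Submodule.mapQ_apply _ _ _ _
    | mul x y hx hy =>
      intro v
      rw [map_mul, map_mul, Module.End.mul_apply, Module.End.mul_apply, hy, hx]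
    | add x y hx hy =>
      intro v
      rw [map_add, map_add, LinearMap.add_apply, LinearMap.add_apply, hy, hx,
        Submodule.Quotient.mk_add]
  refine ⟨RingQuot.liftAlgHom K2 ⟨ψ, fun {x y} hxy => ?_⟩, fun g v => ?_⟩
  · refine LinearMap.ext fun z => ?_
    obtain ⟨v, rfl⟩ := Submodule.Quotient.mk_surjective _ z
    rw [hψ, hψ, Submodule.Quotient.eq]
    exact genOp_respects_rel hoff hsym ht hxy v
  · rw [gU, RingQuot.liftAlgHom_mkAlgHom_apply, hψ, FreeAlgebra.lift_ι_apply]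

/-- The linear map sending a word to the corresponding monomial in the `e_i`. -/
def monomialMap {n : ℕ} (a : Fin n → Fin n → ℤ) (d : Fin n → ℤ) :
    WordModule K2 n →ₗ[K2] Uq a d :=
  (wordBasis K2 n).constr K2 fun w => (w.map fun i => gU a d (Gen.e i)).prod

theorem monomialMap_nil {n : ℕ} (a : Fin n → Fin n → ℤ) (d : Fin n → ℤ) :
    monomialMap a d (wordBasis K2 n []) = 1 := by
  rw [monomialMap, Module.Basis.constr_basis, List.map_nil, List.prod_nil]

theorem monomialMap_consOp {n : ℕ} (a : Fin n → Fin n → ℤ) (d : Fin n → ℤ) (j : Fin n)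
    (x : WordModule K2 n) :
    monomialMap a d (consOp j x) = gU a d (Gen.e j) * monomialMap a d x := by
  have : monomialMap a d ∘ₗ consOp j =
      LinearMap.mulLeft K2 (gU a d (Gen.e j)) ∘ₗ monomialMap a d := by
    refine (wordBasis K2 n).ext fun w => ?_
    rw [LinearMap.comp_apply, LinearMap.comp_apply, consOp_single, monomialMap,
      Module.Basis.constr_basis, Module.Basis.constr_basis, LinearMap.mulLeft_apply,
      List.map_cons, List.prod_cons]
  exact LinearMap.congr_fun this x

theorem monomialMap_consOp_pow {n : ℕ} (a : Fin n → Fin n → ℤ) (d : Fin n → ℤ) (j : Fin n)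
    (k : ℕ) (x : WordModule K2 n) :
    monomialMap a d ((consOp j ^ k) x) = gU a d (Gen.e j) ^ k * monomialMap a d x := by
  induction k with
  | zero => rw [pow_zero, pow_zero, Module.End.one_apply, one_mul]
  | succ k ih => rw [pow_succ', pow_succ', Module.End.mul_apply, monomialMap_consOp, ih, mul_assoc]

theorem serre_relation_gU {n : ℕ} (a : Fin n → Fin n → ℤ) (d : Fin n → ℤ) {i j : Fin n}
    (hij : i ≠ j) :
    ∑ k ∈ Finset.range ((1 - a i j).toNat + 1),
      ((-1 : K2) ^ k * qbinom (rr ^ d i * (ss ^ d i)⁻¹) ((1 - a i j).toNat) k *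
          ccoef a d rr ss i j k) •
        (gU a d (Gen.e i) ^ ((1 - a i j).toNat - k) * gU a d (Gen.e j) *
          gU a d (Gen.e i) ^ k) = 0 := by
  have h := RingQuot.mkAlgHom_rel K2 (URel.serreE (a := a) (d := d) i j hij)
  simpa only [serreElt, map_sum, map_smul, map_mul, map_pow, map_zero, gU] using h

theorem monomialMap_eq_zero {n : ℕ} {a : Fin n → Fin n → ℤ} {d : Fin n → ℤ}
    {x : WordModule K2 n} (hx : x ∈ serreSubmodule a d rr ss) : monomialMap a d x = 0 := by
  refine serreSubmodule_induction (N := LinearMap.ker (monomialMap a d))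
    (fun i j v hij => ?_) (fun k x _ ih => ?_) hx <;> rw [LinearMap.mem_ker] at *
  · rw [← zero_mul (monomialMap a d v), ← serre_relation_gU a d hij, serreElt,
      LinearMap.sum_apply, map_sum, Finset.sum_mul]
    refine Finset.sum_congr rfl fun k _ => ?_
    rw [LinearMap.smul_apply, map_smul, Module.End.mul_apply, Module.End.mul_apply,
      monomialMap_consOp_pow, monomialMap_consOp, monomialMap_consOp_pow, smul_mul_assoc]
    simp only [mul_assoc]
  · rw [monomialMap_consOp, ih, mul_zero]

/-- Elements of `U⁺` act on all the Verma modules through one operator on words, which lifts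
their left multiplication. -/
theorem exists_word_operator {n : ℕ} {a : Fin n → Fin n → ℤ} {d : Fin n → ℤ} {L : Uq a d}
    (hL : L ∈ Upos a d) :
    ∃ T : Module.End K2 (WordModule K2 n),
      (∀ x, monomialMap a d (T x) = L * monomialMap a d x) ∧
      ∀ (t : K2)
        (ρ : Uq a d →ₐ[K2] Module.End K2 (WordModule K2 n ⧸ serreSubmodule a d rr ss)),
        (∀ g v, ρ (gU a d g) (Submodule.Quotient.mk v) =
          Submodule.Quotient.mk (genOp a d t g v)) →
        ∀ v, ρ L (Submodule.Quotient.mk v) = Submodule.Quotient.mk (T v) := by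
  induction hL using Algebra.adjoin_induction with
  | mem x hx =>
    obtain ⟨j, rfl⟩ := hx
    exact ⟨consOp j, monomialMap_consOp a d j, fun t ρ h v => h (Gen.e j) v⟩
  | algebraMap c =>
    refine ⟨algebraMap K2 _ c, fun x => ?_, fun t ρ h v => ?_⟩
    · rw [Module.algebraMap_end_apply, map_smul, Algebra.smul_def]
    · rw [AlgHom.commutes, Module.algebraMap_end_apply, Module.algebraMap_end_apply,
        Submodule.Quotient.mk_smul]
  | add x y _ _ hx hy =>
    obtain ⟨T, hT, hT'⟩ := hx
    obtain ⟨S, hS, hS'⟩ := hy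
    refine ⟨T + S, fun x => ?_, fun t ρ h v => ?_⟩
    · rw [LinearMap.add_apply, map_add, hT, hS, add_mul]
    · rw [map_add, LinearMap.add_apply, LinearMap.add_apply, hT' t ρ h, hS' t ρ h,
        Submodule.Quotient.mk_add]
  | mul x y _ _ hx hy =>
    obtain ⟨T, hT, hT'⟩ := hx
    obtain ⟨S, hS, hS'⟩ := hy
    refine ⟨T * S, fun x => ?_, fun t ρ h v => ?_⟩
    · rw [Module.End.mul_apply, hT, hS, mul_assoc]
    · rw [map_mul, Module.End.mul_apply, Module.End.mul_apply, hS' t ρ h, hT' t ρ h]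

theorem monomialMap_eq_zero_of_charOp_mem {n : ℕ} {a : Fin n → Fin n → ℤ} {d : Fin n → ℤ}
    {χ : Fin n → K2} (hχ : ∀ j, χ j ≠ 0) {x : WordModule K2 n}
    (hx : charOp 1 χ x ∈ serreSubmodule a d rr ss) : monomialMap a d x = 0 := by
  have h := charOp_mem_serreSubmodule 1⁻¹ χ⁻¹ hx
  rw [← Module.End.mul_apply, charOp_inv_mul one_ne_zero hχ, Module.End.one_apply] at h
  exact monomialMap_eq_zero h

/-- The subspaces `ω_i U⁺` and `ω_i' U⁺` meet trivially. -/
theorem eq_zero_of_omega_mul_eq {n : ℕ} {a : Fin n → Fin n → ℤ} {d : Fin n → ℤ}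
    (hoff : ∀ i j, i ≠ j → a i j ≤ 0) (hsym : ∀ i j, d i * a i j = d j * a j i) {i : Fin n}
    {L R : Uq a d} (hL : L ∈ Upos a d) (hR : R ∈ Upos a d)
    (h : gU a d (Gen.w i) * L = gU a d (Gen.w' i) * R) : L = 0 ∧ R = 0 := by
  obtain ⟨T, hT, hT'⟩ := exists_word_operator hL
  obtain ⟨S, hS, hS'⟩ := exists_word_operator hR
  have hL' := hT (wordBasis K2 n [])
  have hR' := hS (wordBasis K2 n [])
  rw [monomialMap_nil, mul_one] at hL' hR'
  have key : ∀ t : K2, t ≠ 0 →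
      charOp 1 (omegaChar a d rr ss i) (T (wordBasis K2 n [])) -
        t • charOp 1 (omegaChar' a d rr ss i) (S (wordBasis K2 n [])) ∈
          serreSubmodule a d rr ss := by
    intro t ht
    obtain ⟨ρ, hρ⟩ := exists_verma_representation hoff hsym ht
    have := congrArg (fun z => ρ z (Submodule.Quotient.mk (wordBasis K2 n []))) h
    simp only [map_mul, Module.End.mul_apply, hT' t ρ hρ, hS' t ρ hρ, hρ] at this
    rwa [Submodule.Quotient.eq, genOp, genOp, charOp_eq_smul t, LinearMap.smul_apply] at this
  have h₁ := key 1 one_ne_zero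
  have h₂ := key 2 two_ne_zero
  have hS₀ := Submodule.sub_mem _ h₁ h₂
  rw [sub_sub_sub_cancel_left, ← sub_smul, show (2 : K2) - 1 = 1 by norm_num, one_smul] at hS₀
  have hT₀ := Submodule.add_mem _ h₁ hS₀
  rw [one_smul, sub_add_cancel] at hT₀
  rw [← hL', ← hR']
  exact ⟨monomialMap_eq_zero_of_charOp_mem (omegaChar_ne_zero a d rr_ne_zero ss_ne_zero i) hT₀,
    monomialMap_eq_zero_of_charOp_mem (omegaChar'_ne_zero a d rr_ne_zero ss_ne_zero i) hS₀⟩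

theorem gU_ef {n : ℕ} (a : Fin n → Fin n → ℤ) (d : Fin n → ℤ) (i j : Fin n) :
    gU a d (Gen.e i) * gU a d (Gen.f j) - gU a d (Gen.f j) * gU a d (Gen.e i) =
      if i = j then (rr ^ d i - ss ^ d i)⁻¹ • (gU a d (Gen.w i) - gU a d (Gen.w' i)) else 0 := by
  have h := RingQuot.mkAlgHom_rel K2 (URel.ef (a := a) (d := d) i j)
  rw [map_sub, map_mul, map_mul] at h
  rw [gU, gU, h]
  split_ifs
  · rw [map_smul, map_sub, gU, gU]
  · rw [map_zero]

theorem gU_we {n : ℕ} (a : Fin n → Fin n → ℤ) (d : Fin n → ℤ) (i j : Fin n) :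
    gU a d (Gen.w i) * gU a d (Gen.e j) =
      omegaChar a d rr ss i j • (gU a d (Gen.e j) * gU a d (Gen.w i)) := by
  have h := RingQuot.mkAlgHom_rel K2 (URel.we (a := a) (d := d) i j)
  rwa [map_smul, map_mul, map_mul] at h

theorem gU_w'e {n : ℕ} (a : Fin n → Fin n → ℤ) (d : Fin n → ℤ) (i j : Fin n) :
    gU a d (Gen.w' i) * gU a d (Gen.e j) =
      omegaChar' a d rr ss i j • (gU a d (Gen.e j) * gU a d (Gen.w' i)) := by
  have h := RingQuot.mkAlgHom_rel K2 (URel.w'e (a := a) (d := d) i j)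
  rwa [map_smul, map_mul, map_mul] at h

/-- An element that skew commutes with every `e_j` normalises the algebra they generate. -/
theorem exists_mul_eq_mul_of_skew {K A ι : Type*} [Field K] [Ring A] [Algebra K A] {e : ι → A}
    {w : A} {χ : ι → K} (hχ : ∀ j, χ j ≠ 0) (hw : ∀ j, w * e j = χ j • (e j * w)) {P : A}
    (hP : P ∈ Algebra.adjoin K (Set.range e)) :
    ∃ P' ∈ Algebra.adjoin K (Set.range e), P * w = w * P' := by
  induction hP using Algebra.adjoin_induction with
  | mem x hx =>
    obtain ⟨j, rfl⟩ := hx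
    refine ⟨(χ j)⁻¹ • e j, Subalgebra.smul_mem _
      (Algebra.subset_adjoin (Set.mem_range_self j)) _, ?_⟩
    rw [mul_smul_comm, hw, smul_smul, inv_mul_cancel₀ (hχ j), one_smul]
  | algebraMap c => exact ⟨_, Subalgebra.algebraMap_mem _ c, Algebra.commutes c w⟩
  | add x y _ _ hx hy =>
    obtain ⟨x', hx', hx⟩ := hx
    obtain ⟨y', hy', hy⟩ := hy
    exact ⟨x' + y', add_mem hx' hy', by rw [add_mul, hx, hy, mul_add]⟩
  | mul x y _ _ hx hy =>
    obtain ⟨x', hx', hx⟩ := hx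
    obtain ⟨y', hy', hy⟩ := hy
    exact ⟨x' * y', mul_mem hx' hy', by rw [mul_assoc, hy, ← mul_assoc, hx, mul_assoc]⟩

theorem exists_skew_derivatives {K A ι : Type*} [Field K] [Ring A] [Algebra K A] {e : ι → A}
    {f w w' : A} {χ χ' : ι → K} {c : K} (hχ : ∀ j, χ j ≠ 0) (hχ' : ∀ j, χ' j ≠ 0)
    (hw : ∀ j, w * e j = χ j • (e j * w)) (hw' : ∀ j, w' * e j = χ' j • (e j * w'))
    (hef : ∀ j, ∃ ε : K, c • (e j * f - f * e j) = ε • (w - w')) {P : A}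
    (hP : P ∈ Algebra.adjoin K (Set.range e)) :
    ∃ L ∈ Algebra.adjoin K (Set.range e), ∃ R ∈ Algebra.adjoin K (Set.range e),
      c • (P * f - f * P) = w * L - w' * R := by
  induction hP using Algebra.adjoin_induction with
  | mem x hx =>
    obtain ⟨j, rfl⟩ := hx
    obtain ⟨ε, hε⟩ := hef j
    refine ⟨ε • 1, Subalgebra.smul_mem _ (one_mem _) _, ε • 1,
      Subalgebra.smul_mem _ (one_mem _) _, ?_⟩
    rw [hε, mul_smul_comm, mul_smul_comm, mul_one, mul_one, smul_sub]
  | algebraMap c =>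
    exact ⟨0, zero_mem _, 0, zero_mem _, by
      rw [Algebra.commutes, sub_self, smul_zero, mul_zero, mul_zero, sub_zero]⟩
  | add x y _ _ hx hy =>
    obtain ⟨L, hL, R, hR, hx⟩ := hx
    obtain ⟨L', hL', R', hR', hy⟩ := hy
    refine ⟨L + L', add_mem hL hL', R + R', add_mem hR hR', ?_⟩
    rw [add_mul, mul_add, add_sub_add_comm, smul_add, hx, hy, mul_add, mul_add,
      add_sub_add_comm]
  | mul x y hxm hym hx hy =>
    obtain ⟨L, hL, R, hR, hx⟩ := hx
    obtain ⟨L', hL', R', hR', hy⟩ := hy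
    obtain ⟨X, hX, hxw⟩ := exists_mul_eq_mul_of_skew hχ hw hxm
    obtain ⟨X', hX', hxw'⟩ := exists_mul_eq_mul_of_skew hχ' hw' hxm
    refine ⟨X * L' + L * y, add_mem (mul_mem hX hL') (mul_mem hL hym),
      X' * R' + R * y, add_mem (mul_mem hX' hR') (mul_mem hR hym), ?_⟩
    have h : x * y * f - f * (x * y) = x * (y * f - f * y) + (x * f - f * x) * y := by
      noncomm_ring
    rw [h, smul_add, ← mul_smul_comm, ← smul_mul_assoc, hx, hy, mul_sub, ← mul_assoc,
      ← mul_assoc x, hxw, hxw']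
    noncomm_ring

theorem existsUnique_skew_derivatives_of_disjoint {K A ι : Type*} [Field K] [Semiring A]
    [Algebra K A] {e : ι → A} {f w w' : A} {χ χ' : ι → K} {c : K} (hχ : ∀ j, χ j ≠ 0)
    (hχ' : ∀ j, χ' j ≠ 0) (hw : ∀ j, w * e j = χ j • (e j * w))
    (hw' : ∀ j, w' * e j = χ' j • (e j * w'))
    (hef : ∀ j, ∃ ε : K, c • (e j * f + (-1 : K) • (f * e j)) = ε • (w + (-1 : K) • w'))
    (hdisj : ∀ L ∈ Algebra.adjoin K (Set.range e), ∀ R ∈ Algebra.adjoin K (Set.range e),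
      w * L = w' * R → L = 0 ∧ R = 0) {P : A} (hP : P ∈ Algebra.adjoin K (Set.range e)) :
    ∃! LR : A × A, LR.1 ∈ Algebra.adjoin K (Set.range e) ∧
      LR.2 ∈ Algebra.adjoin K (Set.range e) ∧
        c • (P * f + (-1 : K) • (f * P)) = w * LR.1 + (-1 : K) • (w' * LR.2) := by
  let _ : Ring A := Algebra.semiringToRing K
  simp only [neg_one_smul, ← sub_eq_add_neg] at hef ⊢
  obtain ⟨L, hL, R, hR, h⟩ := exists_skew_derivatives hχ hχ' hw hw' hef hP
  refine ⟨(L, R), ⟨hL, hR, h⟩, ?_⟩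
  rintro ⟨L', R'⟩ ⟨hL', hR', h'⟩
  have hLR : w * (L' - L) = w' * (R' - R) := by
    rw [mul_sub, mul_sub, sub_eq_sub_iff_sub_eq_sub, ← h, ← h']
  obtain ⟨hL₀, hR₀⟩ := hdisj _ (sub_mem hL' hL) _ (sub_mem hR' hR) hLR
  exact Prod.ext (sub_eq_zero.mp hL₀) (sub_eq_zero.mp hR₀)

theorem sub_eq_add_neg_one_smul {K A : Type*} [CommRing K] [Ring A] [Algebra K A] (x y : A) :
    x - y = x + (-1 : K) • y := by
  rw [neg_one_smul, sub_eq_add_neg]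

theorem uq_sub_eq {n : ℕ} {a : Fin n → Fin n → ℤ} {d : Fin n → ℤ} (x y : Uq a d) :
    x - y = x + (-1 : K2) • y := by
  obtain ⟨x, rfl⟩ := RingQuot.mkAlgHom_surjective K2 (URel a d) x
  obtain ⟨y, rfl⟩ := RingQuot.mkAlgHom_surjective K2 (URel a d) y
  refine (map_sub (RingQuot.mkAlgHom K2 (URel a d)) x y).symm.trans ?_
  rw [← map_smul, ← map_add]
  exact congrArg _ (sub_eq_add_neg_one_smul x y)

theorem smul_gU_ef {n : ℕ} (a : Fin n → Fin n → ℤ) (d : Fin n → ℤ) (i j : Fin n) :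
    ∃ ε : K2, (rr ^ d i - ss ^ d i) • (gU a d (Gen.e j) * gU a d (Gen.f i) +
      (-1 : K2) • (gU a d (Gen.f i) * gU a d (Gen.e j))) =
        ε • (gU a d (Gen.w i) + (-1 : K2) • gU a d (Gen.w' i)) := by
  rw [← uq_sub_eq, ← uq_sub_eq, gU_ef]
  split_ifs with h
  · subst h
    exact ⟨_, smul_smul _ _ _⟩
  · exact ⟨0, (smul_zero _).trans (zero_smul _ _).symm⟩

/-- **Proposition 4.1.** For every `i ∈ I` and every `P ∈ U⁺` there exist unique
`L, R ∈ U⁺` with `(r_i - s_i)(P f_i - f_i P) = ω_i L - ω_i' R` (one writes `∂_i(P) = L`,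
`∂_i'(P) = R`). -/
theorem existsUnique_skew_derivatives
    (n : ℕ) (a : Fin n → Fin n → ℤ) (d : Fin n → ℤ)
    (hdiag : ∀ i, a i i = 2) (hoff : ∀ i j, i ≠ j → a i j ≤ 0)
    (hsym : ∀ i j, d i * a i j = d j * a j i) (hdpos : ∀ i, 0 < d i)
    (hfin : Matrix.PosDef (Matrix.of fun i j : Fin n => ((d i * a i j : ℤ) : ℝ)))
    (i : Fin n) (P : Uq a d) (hP : P ∈ Upos a d) :
    ∃! LR : Uq a d × Uq a d, LR.1 ∈ Upos a d ∧ LR.2 ∈ Upos a d ∧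
      (rr ^ d i - ss ^ d i) • (P * gU a d (Gen.f i) - gU a d (Gen.f i) * P) =
        gU a d (Gen.w i) * LR.1 - gU a d (Gen.w' i) * LR.2 := by
  simp only [uq_sub_eq]
  exact existsUnique_skew_derivatives_of_disjoint
    (omegaChar_ne_zero a d rr_ne_zero ss_ne_zero i)
    (omegaChar'_ne_zero a d rr_ne_zero ss_ne_zero i) (gU_we a d i) (gU_w'e a d i)
    (smul_gU_ef a d i) (fun _ hL _ hR => eq_zero_of_omega_mul_eq hoff hsym hL hR) hP

end
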